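/- arXiv:2202.02066 — 3 statements merged into one kernel-verified Lean document; each statement's English description precedes it below -/
import Mathlib

section
/- Let F be a parabolic Cantor set generated by {h_i}_{i∈I}, and suppose some h_i has a parabolic fixed point (a point p with h_i(p)=p and |h_i'(p)|=1). Let ℙ be a Borel probability measure on Σ for which there exists θ ∈ (0,1) such that for all sufficiently large n and all words i ∈ I^n, ℙ([i]) ≤ θ^n, and let μ := ℙ∘Π^{-1}. Then D_μ(−∞) := liminf_{r→0} sup_{x∈F} log μ(B(x,r))/log r = +∞. -/
open Set Filter MeasureTheory Metric Topology
open scoped ENNReal NNReal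

/-- Composition of the maps along a finite word: `h_{i₁…iₙ} = h_{i₁} ∘ ⋯ ∘ h_{iₙ}`. -/
def wMap {I : Type} (h : I → ℝ → ℝ) : List I → ℝ → ℝ
  | [] => id
  | a :: t => h a ∘ wMap h t

/-- Derivative cocycle of the composition along a finite word (chain rule). -/
def wDeriv {I : Type} (h h' : I → ℝ → ℝ) : List I → ℝ → ℝ
  | [] => fun _ => 1
  | a :: t => fun x => h' a (wMap h t x) * wDeriv h h' t x

/-- `‖h_w'‖_∞`, the sup of `|h_w'|` over `[0,1]`. -/
noncomputable def supD {I : Type} (h h' : I → ℝ → ℝ) (w : List I) : ℝ :=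
  ⨆ x : Icc (0:ℝ) 1, |wDeriv h h' w x|

/-- The cylinder of infinite words beginning with the finite word `w`. -/
def cyl {I : Type} (w : List I) : Set (ℕ → I) := {ω | ∀ k : Fin w.length, ω k = w.get k}

/-- A parabolic IFS on `[0,1]` satisfying A1', A2', A3' (parabolic Cantor set system). -/
structure PCantorIFS (I : Type) [Fintype I] where
  h : I → ℝ → ℝ
  h' : I → ℝ → ℝ
  αh : ℝ
  αh_pos : 0 < αh
  card : 2 ≤ Fintype.card I
  maps : ∀ i, MapsTo (h i) (Icc (0:ℝ) 1) (Icc (0:ℝ) 1)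
  contract : ∀ i, ∀ x ∈ Icc (0:ℝ) 1, ∀ y ∈ Icc (0:ℝ) 1, x ≠ y → |h i x - h i y| < |x - y|
  hasDeriv : ∀ i, ∀ x ∈ Icc (0:ℝ) 1, HasDerivWithinAt (h i) (h' i x) (Icc (0:ℝ) 1) x
  holder : ∃ C > 0, ∀ i, ∀ x ∈ Icc (0:ℝ) 1, ∀ y ∈ Icc (0:ℝ) 1,
      |h' i x - h' i y| ≤ C * |x - y| ^ αh
  nonzero : ∀ i, ∀ x ∈ Icc (0:ℝ) 1, h' i x ≠ 0
  sep : ∀ i j, i ≠ j → Disjoint (h i '' Ioo (0:ℝ) 1) (h j '' Ioo (0:ℝ) 1)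

/-- The induced (hyperbolic) alphabet `I_∞ = {j i₀ : j ∈ (I ∖ {i₀})^*} ∪ {i₀}`. -/
def Iinf {I : Type} (i0 : I) : Set (List I) :=
  {w | ∃ j : List I, (∀ a ∈ j, a ≠ i0) ∧ w = j ++ [i0]}

/-- Finite concatenations of words from `I_∞`. -/
def IinfStar {I : Type} (i0 : I) : Set (List I) :=
  {w | ∃ L : List (List I), (∀ u ∈ L, u ∈ Iinf i0) ∧ w = L.flatten}

/-- The truncated induced alphabet `I_N`. -/
def IN {I : Type} (i0 : I) (N : ℕ) : Set (List I) :=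
  {w | w ∈ Iinf i0 ∧ w.length ≤ N}

/-- The weak quasi-Bernoulli property. -/
def WeakQB {I : Type} [MeasurableSpace I] (P : Measure (ℕ → I)) : Prop :=
  ∃ c : ℕ → ℝ, (∀ n, 0 < c n) ∧
    Tendsto (fun n : ℕ => c n ^ ((n : ℝ)⁻¹)) atTop (𝓝 1) ∧
    ∀ L : List (List I), (∀ w ∈ L, w ≠ []) →
      ((L.map fun w => c w.length).prod)⁻¹ * (L.map fun w => (P (cyl w)).toReal).prod
          ≤ (P (cyl L.flatten)).toReal ∧
        (P (cyl L.flatten)).toReal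
          ≤ (L.map fun w => c w.length).prod * (L.map fun w => (P (cyl w)).toReal).prod

/-- The quasi-Bernoulli property restricted to concatenations of words from `I_∞`. -/
def QBonInf {I : Type} [MeasurableSpace I] (P : Measure (ℕ → I)) (i0 : I) : Prop :=
  ∃ c : ℝ, 1 ≤ c ∧ ∀ u ∈ IinfStar i0, ∀ v ∈ IinfStar i0,
    c⁻¹ * ((P (cyl u)).toReal * (P (cyl v)).toReal) ≤ (P (cyl (u ++ v))).toReal ∧
    (P (cyl (u ++ v))).toReal ≤ c * ((P (cyl u)).toReal * (P (cyl v)).toReal)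

/-- The partition sums `∑_{i ∈ I^n} ℙ([i])^q ‖h_i'‖_∞^s` over the full alphabet. -/
noncomputable def pSum {I : Type} [Fintype I] [MeasurableSpace I]
    (P : Measure (ℕ → I)) (h h' : I → ℝ → ℝ) (n : ℕ) (s q : ℝ) : ℝ :=
  ∑ w : Fin n → I, (P (cyl (List.ofFn w))).toReal ^ q * supD h h' (List.ofFn w) ^ s

/-- The partition sums over `n`-fold concatenations of words from an alphabet `J` of
finite words. -/
noncomputable def zSum {I : Type} [MeasurableSpace I]
    (P : Measure (ℕ → I)) (h h' : I → ℝ → ℝ) (J : Set (List I)) (n : ℕ) (s q : ℝ) : ℝ :=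
  ∑' w : Fin n → ↥J,
    (P (cyl (List.flatten (List.ofFn fun k => ((w k : List I)))))).toReal ^ q *
      supD h h' (List.flatten (List.ofFn fun k => ((w k : List I)))) ^ s

/-- `x ^ q` with the convention `0^0 = 0` used for moment sums. -/
noncomputable def pw (a q : ℝ) : ℝ := if a = 0 then 0 else a ^ q

/-- The `q`-th moment sum of a measure on `ℝ` over the closed intervals of the `δ`-mesh. -/
noncomputable def Dq1 (ν : Measure ℝ) (q δ : ℝ) : ℝ :=
  ∑' k : ℤ, pw ((ν (Icc ((k : ℝ) * δ) (((k : ℝ) + 1) * δ))).toReal) q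

/-- Number of intervals of the `δ`-mesh which intersect `F ⊆ ℝ`. -/
noncomputable def covCount (F : Set ℝ) (δ : ℝ) : ℕ :=
  Set.ncard {k : ℤ | (Icc ((k : ℝ) * δ) (((k : ℝ) + 1) * δ) ∩ F).Nonempty}

/-- A continuous injective function on `[a, b]` maps interior points strictly between the images
of the endpoints. -/
lemma ContinuousOn.between_endpoints_of_injOn {f : ℝ → ℝ} {a b x : ℝ}
    (hc : ContinuousOn f (Icc a b)) (hi : InjOn f (Icc a b)) (hx : x ∈ Ioo a b) :
    (f a < f x ∧ f x < f b) ∨ (f b < f x ∧ f x < f a) := by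
  have hab : a ≤ b := (hx.1.trans hx.2).le
  have ha := left_mem_Icc.2 hab
  have hb := right_mem_Icc.2 hab
  have hx' := Ioo_subset_Icc_self hx
  rcases hc.strictMonoOn_of_injOn_Icc' hab hi with h | h
  · exact Or.inl ⟨h ha hx' hx.1, h hx' hb hx.2⟩
  · exact Or.inr ⟨h hx' hb hx.2, h ha hx' hx.1⟩

lemma ContinuousOn.ball_subset_image_Ioo_of_injOn {f : ℝ → ℝ} {a b x r : ℝ}
    (hc : ContinuousOn f (Icc a b)) (hi : InjOn f (Icc a b)) (hx : x ∈ Ioo a b)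
    (ha : r ≤ |f a - f x|) (hb : r ≤ |f b - f x|) : ball (f x) r ⊆ f '' Ioo a b := by
  intro z hz
  have hab : a ≤ b := (hx.1.trans hx.2).le
  rw [mem_ball, Real.dist_eq, abs_lt] at hz
  rcases hc.between_endpoints_of_injOn hi hx with ⟨h1, h2⟩ | ⟨h1, h2⟩
  · rw [abs_of_neg (by linarith)] at ha
    rw [abs_of_pos (by linarith)] at hb
    exact intermediate_value_Ioo hab hc ⟨by linarith, by linarith⟩
  · rw [abs_of_pos (by linarith)] at ha
    rw [abs_of_neg (by linarith)] at hb
    exact intermediate_value_Ioo' hab hc ⟨by linarith, by linarith⟩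

lemma ContinuousOn.image_Ioo_mem_nhds_of_injOn {f : ℝ → ℝ} {a b x : ℝ}
    (hc : ContinuousOn f (Icc a b)) (hi : InjOn f (Icc a b)) (hx : x ∈ Ioo a b) :
    f '' Ioo a b ∈ 𝓝 (f x) := by
  have hr : 0 < min |f a - f x| |f b - f x| := by
    rcases hc.between_endpoints_of_injOn hi hx with ⟨h1, h2⟩ | ⟨h1, h2⟩ <;>
      exact lt_min (abs_pos.2 (by linarith)) (abs_pos.2 (by linarith))
  exact mem_of_superset (ball_mem_nhds _ hr)
    (hc.ball_subset_image_Ioo_of_injOn hi hx (min_le_left _ _) (min_le_right _ _))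

lemma wMap_replicate {I : Type} (h : I → ℝ → ℝ) (i : I) (n : ℕ) :
    wMap h (List.replicate n i) = (h i)^[n] := by
  induction n with
  | zero => rfl
  | succ n ih => rw [List.replicate_succ, Function.iterate_succ', ← ih]; rfl

namespace PCantorIFS

variable {I : Type} [Fintype I] (S : PCantorIFS I)

lemma continuousOn (i : I) : ContinuousOn (S.h i) (Icc 0 1) :=
  fun x hx => (S.hasDeriv i x hx).continuousWithinAt

lemma exists_deriv_eq_slope (i : I) {x y : ℝ} (hx : x ∈ Icc (0:ℝ) 1) (hy : y ∈ Icc (0:ℝ) 1)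
    (hxy : x < y) : ∃ c ∈ Ioo x y, S.h i y - S.h i x = S.h' i c * (y - x) := by
  obtain ⟨c, hc, h⟩ := exists_hasDerivAt_eq_slope (S.h i) (S.h' i) hxy
    ((S.continuousOn i).mono (Icc_subset_Icc hx.1 hy.2)) (fun z hz =>
      (S.hasDeriv i z ⟨hx.1.trans hz.1.le, hz.2.le.trans hy.2⟩).hasDerivAt
        (Icc_mem_nhds (hx.1.trans_lt hz.1) (hz.2.trans_le hy.2)))
  exact ⟨c, hc, by rw [h, div_mul_cancel₀ _ (sub_pos.2 hxy).ne']⟩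

lemma injOn (i : I) : InjOn (S.h i) (Icc 0 1) := by
  have key : ∀ x ∈ Icc (0:ℝ) 1, ∀ y ∈ Icc (0:ℝ) 1, x < y → S.h i x ≠ S.h i y := by
    intro x hx y hy hxy h
    obtain ⟨c, hc, hs⟩ := S.exists_deriv_eq_slope i hx hy hxy
    have := mul_ne_zero (S.nonzero i c ⟨hx.1.trans hc.1.le, hc.2.le.trans hy.2⟩)
      (sub_pos.2 hxy).ne'
    exact this (by rw [← hs, h, sub_self])
  intro x hx y hy h
  by_contra hne
  rcases lt_or_gt_of_ne hne with hlt | hlt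
  · exact key x hx y hy hlt h
  · exact key y hy x hx hlt h.symm

lemma mapsTo_iterate (i : I) (n : ℕ) : MapsTo (S.h i)^[n] (Icc 0 1) (Icc 0 1) :=
  (S.maps i).iterate n

lemma continuousOn_iterate (i : I) (n : ℕ) : ContinuousOn (S.h i)^[n] (Icc 0 1) :=
  (S.continuousOn i).iterate (S.maps i) n

lemma injOn_iterate (i : I) (n : ℕ) : InjOn (S.h i)^[n] (Icc 0 1) :=
  (S.injOn i).iterate (S.maps i) n

lemma mapsTo_Ioo (i : I) : MapsTo (S.h i) (Ioo 0 1) (Ioo 0 1) := by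
  intro x hx
  have h0 := S.maps i (left_mem_Icc.2 zero_le_one)
  have h1 := S.maps i (right_mem_Icc.2 zero_le_one)
  rcases (S.continuousOn i).between_endpoints_of_injOn (S.injOn i) hx with ⟨ha, hb⟩ | ⟨ha, hb⟩
  · exact ⟨h0.1.trans_lt ha, hb.trans_le h1.2⟩
  · exact ⟨h1.1.trans_lt ha, hb.trans_le h0.2⟩

/-- The separation condition extends to one closed image. -/
lemma eq_of_mem_image_Ioo_of_mem_image_Icc {i j : I} {z : ℝ} (hi : z ∈ S.h i '' Ioo 0 1)
    (hj : z ∈ S.h j '' Icc 0 1) : j = i := by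
  by_contra hne
  obtain ⟨x, hx, rfl⟩ := hi
  have hcl : closure (Ioo (0:ℝ) 1) = Icc 0 1 := closure_Ioo zero_ne_one
  have hc : ContinuousOn (S.h j) (closure (Ioo (0:ℝ) 1)) := hcl ▸ S.continuousOn j
  rw [← hcl] at hj
  obtain ⟨w, hw1, hw2⟩ := mem_closure_iff_nhds.1 (hc.image_closure hj) _
    ((S.continuousOn i).image_Ioo_mem_nhds_of_injOn (S.injOn i) hx)
  exact disjoint_left.1 (S.sep j i hne) hw2 hw1

/-- Two different maps cannot share a fixed point. -/
lemma ne_of_fixed {i j : I} (hne : j ≠ i) {p : ℝ} (hp : p ∈ Icc (0:ℝ) 1) (hip : S.h i p = p) :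
    S.h j p ≠ p := by
  intro hjp
  have hhalf : (1/2 : ℝ) ∈ Ioo (0:ℝ) 1 := by norm_num
  have hhalf' := Ioo_subset_Icc_self hhalf
  have hpI : p ∉ Ioo (0:ℝ) 1 := fun h =>
    disjoint_left.1 (S.sep j i hne) ⟨p, h, hjp⟩ ⟨p, h, hip⟩
  have hphalf : p ≠ 1/2 := fun h => hpI (h ▸ hhalf)
  have hmem : ∀ k, S.h k p = p → ∀ z ∈ uIcc p (S.h k (1/2)), z ≠ p → z ∈ S.h k '' Ioo 0 1 := by
    intro k hk z hz hzp
    have hsub : uIcc p (1/2) ⊆ Icc (0:ℝ) 1 := uIcc_subset_Icc hp hhalf'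
    have hz' : z ∈ uIcc (S.h k p) (S.h k (1/2)) := by rwa [hk]
    obtain ⟨t, ht, rfl⟩ := intermediate_value_uIcc ((S.continuousOn k).mono hsub) hz'
    refine ⟨t, ?_, rfl⟩
    have htp : t ≠ p := fun h => hzp (by rw [h, hk])
    have htI := hsub ht
    rcases eq_endpoints_or_mem_Ioo_of_mem_Icc hp with h | h | h
    · rw [h, uIcc_of_le (by norm_num)] at ht
      exact ⟨lt_of_le_of_ne ht.1 (fun e => htp (by rw [h, e])), by linarith [ht.2]⟩
    · rw [h, uIcc_of_ge (by norm_num)] at ht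
      exact ⟨by linarith [ht.1], lt_of_le_of_ne ht.2 (fun e => htp (by rw [h, e]))⟩
    · exact absurd h hpI
  have hA : S.h i (1/2) ≠ p := fun h => hphalf (S.injOn i hp hhalf' (by rw [hip, h]))
  have hB : S.h j (1/2) ≠ p := fun h => hphalf (S.injOn j hp hhalf' (by rw [hjp, h]))
  have hAI := S.maps i hhalf'
  have hBI := S.maps j hhalf'
  obtain ⟨z, hzA, hzB, hzp⟩ : ∃ z, z ∈ uIcc p (S.h i (1/2)) ∧ z ∈ uIcc p (S.h j (1/2)) ∧ z ≠ p := by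
    rcases eq_endpoints_or_mem_Ioo_of_mem_Icc hp with h | h | h
    · rw [h, uIcc_of_le hAI.1, uIcc_of_le hBI.1]
      refine ⟨min (S.h i (1/2)) (S.h j (1/2)), ⟨le_min hAI.1 hBI.1, min_le_left _ _⟩,
        ⟨le_min hAI.1 hBI.1, min_le_right _ _⟩, ?_⟩
      rcases min_choice (S.h i (1/2)) (S.h j (1/2)) with e | e <;> rw [e]
      exacts [h ▸ hA, h ▸ hB]
    · rw [h, uIcc_of_ge hAI.2, uIcc_of_ge hBI.2]
      refine ⟨max (S.h i (1/2)) (S.h j (1/2)), ⟨le_max_left _ _, max_le hAI.2 hBI.2⟩,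
        ⟨le_max_right _ _, max_le hAI.2 hBI.2⟩, ?_⟩
      rcases max_choice (S.h i (1/2)) (S.h j (1/2)) with e | e <;> rw [e]
      exacts [h ▸ hA, h ▸ hB]
    · exact absurd h hpI
  exact disjoint_left.1 (S.sep j i hne) (hmem j hjp z hzB hzp) (hmem i hip z hzA hzp)

/-- Near a parabolic fixed point the map contracts arbitrarily weakly. -/
lemma exists_weak_contraction {i : I} {p : ℝ} (hp : p ∈ Icc (0:ℝ) 1) (hder : |S.h' i p| = 1)
    {ρ : ℝ} (hρ : ρ < 1) :
    ∃ δ > 0, ∀ x ∈ Icc (0:ℝ) 1 ∩ ball p δ, ∀ y ∈ Icc (0:ℝ) 1 ∩ ball p δ,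
      ρ * |x - y| ≤ |S.h i x - S.h i y| := by
  obtain ⟨C, -, hC⟩ := S.holder
  have hcont : Tendsto (fun t : ℝ => C * |t - p| ^ S.αh) (𝓝 p) (𝓝 0) := by
    have : Continuous fun t : ℝ => C * |t - p| ^ S.αh :=
      continuous_const.mul ((continuous_id.sub continuous_const).abs.rpow_const
        fun _ => Or.inr S.αh_pos.le)
    simpa [Real.zero_rpow S.αh_pos.ne'] using this.tendsto p
  obtain ⟨δ, hδ, hball⟩ := Metric.eventually_nhds_iff_ball.1
    (hcont.eventually (gt_mem_nhds (sub_pos.2 hρ)))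
  refine ⟨δ, hδ, ?_⟩
  have hd : ∀ c ∈ Icc (0:ℝ) 1 ∩ ball p δ, ρ ≤ |S.h' i c| := by
    intro c hc
    have h1 := hC i c hc.1 p hp
    have h2 := hball c hc.2
    have h3 := abs_sub_abs_le_abs_sub (S.h' i p) (S.h' i c)
    rw [abs_sub_comm, hder] at h3
    linarith
  have key : ∀ x ∈ Icc (0:ℝ) 1 ∩ ball p δ, ∀ y ∈ Icc (0:ℝ) 1 ∩ ball p δ, x < y →
      ρ * |y - x| ≤ |S.h i y - S.h i x| := by
    intro x hx y hy hxy
    obtain ⟨c, hc, hs⟩ := S.exists_deriv_eq_slope i hx.1 hy.1 hxy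
    rw [hs, abs_mul]
    refine mul_le_mul_of_nonneg_right (hd c ?_) (abs_nonneg _)
    have hconv : OrdConnected (Icc (0:ℝ) 1 ∩ ball p δ) :=
      ((convex_Icc 0 1).inter (convex_ball p δ)).ordConnected
    exact hconv.out hx hy (Ioo_subset_Icc_self hc)
  intro x hx y hy
  rcases lt_trichotomy x y with h | h | h
  · rw [abs_sub_comm, abs_sub_comm (S.h i x)]
    exact key x hx y hy h
  · simp [h]
  · exact key y hy x hx h

/-- `Pi` sends each infinite word to the unique common point of the nested images of `[0,1]`. -/
abbrev IsCoding (Pi : (ℕ → I) → ℝ) : Prop :=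
  ∀ ω : ℕ → I,
    (⋂ n : ℕ, wMap S.h (List.ofFn fun k : Fin n => ω k) '' Icc (0:ℝ) 1) = {Pi ω}

lemma coding_mem_Icc {Pi : (ℕ → I) → ℝ} (hPi : S.IsCoding Pi) (ω : ℕ → I) : Pi ω ∈ Icc (0:ℝ) 1 := by
  have h : Pi ω ∈ ⋂ n : ℕ, wMap S.h (List.ofFn fun k : Fin n => ω k) '' Icc (0:ℝ) 1 := by
    rw [hPi]; rfl
  simpa [wMap] using mem_iInter.1 h 0

lemma map_coding {Pi : (ℕ → I) → ℝ} (hPi : S.IsCoding Pi)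
    (i : I) (ω τ : ℕ → I) (h0 : τ 0 = i) (hs : ∀ n, τ (n + 1) = ω n) :
    Pi τ = S.h i (Pi ω) := by
  symm
  rw [← mem_singleton_iff, ← hPi, mem_iInter]
  intro n
  have h : Pi ω ∈ ⋂ n : ℕ, wMap S.h (List.ofFn fun k : Fin n => ω k) '' Icc (0:ℝ) 1 := by
    rw [hPi]; rfl
  cases n with
  | zero => simpa [wMap] using S.maps i (S.coding_mem_Icc hPi ω)
  | succ n =>
    obtain ⟨t, ht, he⟩ := mem_iInter.1 h n
    refine ⟨t, ht, ?_⟩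
    rw [← he, List.ofFn_succ]
    simp [wMap, h0, hs]

lemma coding_shift {Pi : (ℕ → I) → ℝ} (hPi : S.IsCoding Pi)
    (ω : ℕ → I) : Pi ω = S.h (ω 0) (Pi fun n => ω (n + 1)) :=
  S.map_coding hPi _ _ _ rfl fun _ => rfl

lemma mapsTo_range_coding {Pi : (ℕ → I) → ℝ} (hPi : S.IsCoding Pi)
    (i : I) : MapsTo (S.h i) (range Pi) (range Pi) := by
  rintro _ ⟨ω, rfl⟩
  exact ⟨fun n => Nat.casesOn n i ω, S.map_coding hPi i ω _ rfl fun _ => rfl⟩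

lemma coding_const {Pi : (ℕ → I) → ℝ} (hPi : S.IsCoding Pi)
    {i : I} {p : ℝ} (hp : p ∈ Icc (0:ℝ) 1) (hip : S.h i p = p) :
    Pi (fun _ => i) = p := by
  symm
  rw [← mem_singleton_iff, ← hPi, mem_iInter]
  intro n
  rw [List.ofFn_const, wMap_replicate]
  exact ⟨p, hp, Function.iterate_fixed hip n⟩

/-- The coding determines the word wherever it lands in the interior of an iterated image. -/
lemma eq_of_coding_mem_image_Ioo {Pi : (ℕ → I) → ℝ} (hPi : S.IsCoding Pi)
    (i : I) (n : ℕ) (ω : ℕ → I)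
    (h : Pi ω ∈ (S.h i)^[n] '' Ioo 0 1) : ∀ k < n, ω k = i := by
  induction n generalizing ω with
  | zero => simp
  | succ n ih =>
    obtain ⟨x, hx, he⟩ := h
    rw [Function.iterate_succ_apply', S.coding_shift hPi ω] at he
    have hxn : (S.h i)^[n] x ∈ Ioo (0:ℝ) 1 := (S.mapsTo_Ioo i).iterate n hx
    have hω := S.coding_mem_Icc hPi fun n => ω (n + 1)
    have h0 : ω 0 = i := S.eq_of_mem_image_Ioo_of_mem_image_Icc ⟨_, hxn, he⟩ ⟨_, hω, rfl⟩
    rw [h0] at he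
    have htail := S.injOn i (Ioo_subset_Icc_self hxn) hω he
    intro k hk
    cases k with
    | zero => exact h0
    | succ k => exact ih _ ⟨x, hx, htail⟩ k (by omega)

lemma exists_mem_range_coding_Ioo {Pi : (ℕ → I) → ℝ} (hPi : S.IsCoding Pi)
    {i : I} {p : ℝ} (hp : p ∈ Icc (0:ℝ) 1) (hip : S.h i p = p) :
    ∃ x ∈ range Pi, x ∈ Ioo (0:ℝ) 1 := by
  obtain ⟨j, hj⟩ := Fintype.exists_ne_of_one_lt_card S.card i
  have hpF : p ∈ range Pi := ⟨_, S.coding_const hPi hp hip⟩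
  have hqF := S.mapsTo_range_coding hPi j hpF
  have hqp : S.h j p ≠ p := S.ne_of_fixed hj hp hip
  have hq := S.maps j hp
  have hr := S.maps i hq
  have hrp : S.h i (S.h j p) ≠ p := fun h => hqp (S.injOn i hq hp (h.trans hip.symm))
  have hrq : S.h i (S.h j p) ≠ S.h j p := by
    intro h
    have := S.contract i _ hq _ hp hqp
    rw [h, hip] at this
    exact lt_irrefl _ this
  rcases eq_endpoints_or_mem_Ioo_of_mem_Icc hp with h | h | h
  rotate_left 2
  · exact ⟨p, hpF, h⟩
  all_goals
    rcases eq_endpoints_or_mem_Ioo_of_mem_Icc hq with h2 | h2 | h2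
    rotate_left 2
    · exact ⟨_, hqF, h2⟩
    all_goals
      rcases eq_endpoints_or_mem_Ioo_of_mem_Icc hr with h3 | h3 | h3
      rotate_left 2
      · exact ⟨_, S.mapsTo_range_coding hPi i hqF, h3⟩
      all_goals grind

lemma exists_forall_iterate_mem_ball {Pi : (ℕ → I) → ℝ} (hPi : S.IsCoding Pi)
    {i : I} {p : ℝ} (hp : p ∈ Icc (0:ℝ) 1) (hip : S.h i p = p)
    {δ : ℝ} (hδ : 0 < δ) :
    ∃ N, ∀ n ≥ N, ∀ x ∈ Icc (0:ℝ) 1, (S.h i)^[n] x ∈ ball p δ := by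
  have hanti : Antitone fun n : ℕ => (S.h i)^[n] '' Icc (0:ℝ) 1 := by
    refine antitone_nat_of_succ_le fun n => ?_
    rintro _ ⟨x, hx, rfl⟩
    exact ⟨S.h i x, S.maps i hx, (Function.iterate_succ_apply _ _ _).symm⟩
  have hcpt : ∀ n : ℕ, IsCompact ((S.h i)^[n] '' Icc (0:ℝ) 1) := fun n =>
    isCompact_Icc.image_of_continuousOn (S.continuousOn_iterate i n)
  have hinter : (⋂ n : ℕ, (S.h i)^[n] '' Icc (0:ℝ) 1) = {p} := by
    have := hPi fun _ => i
    rw [S.coding_const hPi hp hip] at this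
    simpa only [List.ofFn_const, wMap_replicate] using this
  obtain ⟨N, hN⟩ := exists_subset_nhds_of_isCompact' (U := ball p δ)
    (directed_of_isDirected_le hanti) hcpt (fun n => (hcpt n).isClosed) (by
      rw [hinter]
      rintro x rfl
      exact ball_mem_nhds _ hδ)
  exact ⟨N, fun n hn x hx => hN (hanti hn ⟨x, hx, rfl⟩)⟩

/-- The images of `(0,1)` under the iterates of a map with a parabolic fixed point contain
balls, centred in the limit set, whose radii decay slower than any given exponential. -/
lemma exists_ball_subset_iterate_image {Pi : (ℕ → I) → ℝ} (hPi : S.IsCoding Pi)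
    {i : I} {p : ℝ} (hp : p ∈ Icc (0:ℝ) 1)
    (hip : S.h i p = p) (hder : |S.h' i p| = 1) {ρ : ℝ} (hρ0 : 0 < ρ) (hρ : ρ < 1) :
    ∃ c > 0, ∃ N : ℕ, ∀ n ≥ N, ∃ x ∈ range Pi,
      ball x (c * ρ ^ n) ⊆ (S.h i)^[n] '' Ioo 0 1 := by
  obtain ⟨x, hxF, hx⟩ := S.exists_mem_range_coding_Ioo hPi hp hip
  obtain ⟨δ, hδ, hweak⟩ := S.exists_weak_contraction hp hder hρ
  obtain ⟨N, hN⟩ := S.exists_forall_iterate_mem_ball hPi hp hip hδ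
  have hx' := Ioo_subset_Icc_self hx
  have hgrow : ∀ y ∈ Icc (0:ℝ) 1, ∀ m : ℕ,
      ρ ^ m * |(S.h i)^[N] y - (S.h i)^[N] x| ≤ |(S.h i)^[N + m] y - (S.h i)^[N + m] x| := by
    intro y hy m
    induction m with
    | zero => simp
    | succ m ih =>
      rw [← add_assoc, Function.iterate_succ_apply', Function.iterate_succ_apply', pow_succ',
        mul_assoc]
      exact (mul_le_mul_of_nonneg_left ih hρ0.le).trans
        (hweak _ ⟨S.mapsTo_iterate i _ hy, hN _ (by omega) y hy⟩
          _ ⟨S.mapsTo_iterate i _ hx', hN _ (by omega) x hx'⟩)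
  have hpos : ∀ y ∈ Icc (0:ℝ) 1, y ≠ x → 0 < |(S.h i)^[N] y - (S.h i)^[N] x| :=
    fun y hy hyx => abs_pos.2 (sub_ne_zero.2 fun h => hyx (S.injOn_iterate i N hy hx' h))
  have h0 := left_mem_Icc.2 (zero_le_one (α := ℝ))
  have h1 := right_mem_Icc.2 (zero_le_one (α := ℝ))
  refine ⟨min |(S.h i)^[N] 0 - (S.h i)^[N] x| |(S.h i)^[N] 1 - (S.h i)^[N] x|,
    lt_min (hpos 0 h0 hx.1.ne) (hpos 1 h1 hx.2.ne'), N, fun n hn => ?_⟩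
  obtain ⟨m, rfl⟩ := Nat.exists_eq_add_of_le hn
  have hpow : ρ ^ (N + m) ≤ ρ ^ m := pow_le_pow_of_le_one hρ0.le hρ.le (by omega)
  refine ⟨_, (S.mapsTo_range_coding hPi i).iterate (N + m) hxF,
    (S.continuousOn_iterate i _).ball_subset_image_Ioo_of_injOn (S.injOn_iterate i _) hx ?_ ?_⟩
  · refine le_trans ?_ (hgrow 0 h0 m)
    rw [mul_comm]
    exact mul_le_mul hpow (min_le_left _ _) (le_min (abs_nonneg _) (abs_nonneg _)) (by positivity)
  · refine le_trans ?_ (hgrow 1 h1 m)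
    rw [mul_comm]
    exact mul_le_mul hpow (min_le_right _ _) (le_min (abs_nonneg _) (abs_nonneg _)) (by positivity)

end PCantorIFS

/-- If some map of a parabolic Cantor IFS has a parabolic fixed point and
`ℙ([i]) ≤ θⁿ` for all long words `i ∈ Iⁿ`, then the box dimension of `μ = ℙ ∘ Π⁻¹` at `-∞`,
`D_μ(-∞) = liminf_{r → 0} sup_{x ∈ F} log μ(B(x,r))/log r`, is infinite. -/
theorem parabolic_Dinfty_infinite {I : Type} [Fintype I] [MeasurableSpace I]
    [MeasurableSingletonClass I]
    (S : PCantorIFS I)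
    (Pi : (ℕ → I) → ℝ)
    (hPi : ∀ ω : ℕ → I,
      (⋂ n : ℕ, wMap S.h (List.ofFn fun k : Fin n => ω k) '' Icc (0:ℝ) 1) = {Pi ω})
    (hPiM : Measurable Pi)
    (hpara : ∃ i : I, ∃ p ∈ Icc (0:ℝ) 1, S.h i p = p ∧ |S.h' i p| = 1)
    (P : Measure (ℕ → I)) [IsProbabilityMeasure P]
    (θ : ℝ) (hθ : θ ∈ Ioo (0:ℝ) 1)
    (hdecay : ∃ N : ℕ, ∀ n ≥ N, ∀ w : Fin n → I, (P (cyl (List.ofFn w))).toReal ≤ θ ^ n) :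
    Filter.liminf
      (fun r : ℝ => ⨆ x ∈ range Pi,
        ENNReal.log ((P.map Pi) (Metric.ball x r)) * (((Real.log r)⁻¹ : ℝ) : EReal))
      (𝓝[>] (0:ℝ)) = (⊤ : EReal) := by
  obtain ⟨i, p, hp, hip, hder⟩ := hpara
  obtain ⟨N₀, hN₀⟩ := hdecay
  have key : ∀ M : ℝ, 0 < M → ∀ᶠ r in 𝓝[>] (0:ℝ), (M : EReal) ≤ ⨆ x ∈ range Pi,
      ENNReal.log ((P.map Pi) (Metric.ball x r)) * (((Real.log r)⁻¹ : ℝ) : EReal) := by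
    intro M hM
    set a := -Real.log θ with ha_def
    have ha : 0 < a := neg_pos.2 (Real.log_neg hθ.1 hθ.2)
    set b := a / (2 * M) with hb_def
    have hb : 0 < b := by positivity
    obtain ⟨c, hc, N, hball⟩ := S.exists_ball_subset_iterate_image hPi hp hip hder
      (Real.exp_pos (-b)) (Real.exp_lt_one_iff.2 (neg_lt_zero.2 hb))
    filter_upwards [Real.tendsto_log_nhdsGT_zero.eventually_lt_atBot 0,
      Real.tendsto_log_nhdsGT_zero.eventually_le_atBot (-(2 * (b - Real.log c))),
      Real.tendsto_log_nhdsGT_zero.eventually_le_atBot (-(max N N₀ * a / M)),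
      self_mem_nhdsWithin] with r hr0 hr1 hr2 hr
    have hrpos : 0 < r := hr
    set n := ⌈M * -Real.log r / a⌉₊
    have hn_ge : M * -Real.log r / a ≤ n := Nat.le_ceil _
    have hn_lt : (n : ℝ) < M * -Real.log r / a + 1 :=
      Nat.ceil_lt_add_one (div_nonneg (mul_nonneg hM.le (by linarith)) ha.le)
    have hnN : max N N₀ ≤ n := by
      have : ((max N N₀ : ℕ) : ℝ) ≤ n := by
        refine le_trans ?_ hn_ge
        rw [le_div_iff₀ ha, mul_comm M, ← div_le_iff₀ hM]
        linarith
      exact_mod_cast this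
    obtain ⟨x, hx, hsub⟩ := hball n ((le_max_left _ _).trans hnN)
    have hrad : r ≤ c * Real.exp (-b) ^ n := by
      rw [← Real.exp_nat_mul, ← Real.log_le_log_iff hrpos (by positivity),
        Real.log_mul hc.ne' (Real.exp_pos _).ne', Real.log_exp]
      have h1 : (n : ℝ) * b ≤ (M * -Real.log r / a + 1) * b :=
        mul_le_mul_of_nonneg_right hn_lt.le hb.le
      have h2 : M * -Real.log r / a * b = -Real.log r / 2 := by
        rw [hb_def]; field_simp
      linarith
    have hmeas : (P.map Pi) (Metric.ball x r) ≤ ENNReal.ofReal (Real.exp (M * Real.log r)) := by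
      rw [Measure.map_apply hPiM measurableSet_ball]
      have hcyl : Pi ⁻¹' Metric.ball x r ⊆ cyl (List.ofFn fun _ : Fin n => i) := by
        intro ω hω k
        have hk := S.eq_of_coding_mem_image_Ioo hPi i n ω (hsub (ball_subset_ball hrad hω)) k
          (by simpa using k.2)
        simpa using hk
      refine (measure_mono hcyl).trans ?_
      rw [← ENNReal.ofReal_toReal (measure_ne_top P _)]
      refine ENNReal.ofReal_le_ofReal
        ((hN₀ n ((le_max_right _ _).trans hnN) fun _ => i).trans ?_)
      rw [← Real.log_le_iff_le_exp (pow_pos hθ.1 n), Real.log_pow]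
      rw [div_le_iff₀ ha] at hn_ge
      linarith
    have hlog : ENNReal.log ((P.map Pi) (Metric.ball x r)) ≤ ((M * Real.log r : ℝ) : EReal) := by
      refine (ENNReal.log_monotone hmeas).trans ?_
      rw [ENNReal.log_ofReal_of_pos (Real.exp_pos _), Real.log_exp]
    calc (M : EReal)
        = ((M * Real.log r : ℝ) : EReal) * (((Real.log r)⁻¹ : ℝ) : EReal) := by
          rw [← EReal.coe_mul, mul_assoc, mul_inv_cancel₀ hr0.ne, mul_one]
      _ ≤ ENNReal.log ((P.map Pi) (Metric.ball x r)) * (((Real.log r)⁻¹ : ℝ) : EReal) :=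
          EReal.mul_le_mul_of_nonpos_right hlog (by exact_mod_cast (inv_lt_zero.2 hr0).le)
      _ ≤ _ := le_iSup₂_of_le x hx le_rfl
  rw [EReal.eq_top_iff_forall_lt]
  intro y
  have hy : (y : EReal) < ((|y| + 1 : ℝ) : EReal) := by
    exact_mod_cast (le_abs_self y).trans_lt (lt_add_one _)
  exact hy.trans_le (le_liminf_of_le (h := key _ (by positivity)))
end

section
/- Let {S_i}_{i∈I} be an IFS generating a parabolic carpet F, and suppose F is not contained in a vertical or horizontal line. Then there exists a finite word i_0 ∈ I^* such that, writing S_{i_0} = (f_{i_0}, g_{i_0}), both sup_{x∈[0,1]} |f_{i_0}'(x)| < 1 and sup_{x∈[0,1]} |g_{i_0}'(x)| < 1. -/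
open Set Filter MeasureTheory Metric Topology
open scoped ENNReal NNReal

/-- A parabolic carpet IFS on `[0,1]²` satisfying A1, A2, A3. -/
structure PCarpetIFS (I : Type) [Fintype I] where
  f : I → ℝ → ℝ
  g : I → ℝ → ℝ
  f' : I → ℝ → ℝ
  g' : I → ℝ → ℝ
  αf : ℝ
  αg : ℝ
  αf_pos : 0 < αf
  αg_pos : 0 < αg
  card : 2 ≤ Fintype.card I
  mapsf : ∀ i, MapsTo (f i) (Icc (0:ℝ) 1) (Icc (0:ℝ) 1)
  mapsg : ∀ i, MapsTo (g i) (Icc (0:ℝ) 1) (Icc (0:ℝ) 1)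
  contractf : ∀ i, ∀ x ∈ Icc (0:ℝ) 1, ∀ y ∈ Icc (0:ℝ) 1, x ≠ y → |f i x - f i y| < |x - y|
  contractg : ∀ i, ∀ x ∈ Icc (0:ℝ) 1, ∀ y ∈ Icc (0:ℝ) 1, x ≠ y → |g i x - g i y| < |x - y|
  hasDerivf : ∀ i, ∀ x ∈ Icc (0:ℝ) 1, HasDerivWithinAt (f i) (f' i x) (Icc (0:ℝ) 1) x
  hasDerivg : ∀ i, ∀ x ∈ Icc (0:ℝ) 1, HasDerivWithinAt (g i) (g' i x) (Icc (0:ℝ) 1) x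
  holderf : ∃ C > 0, ∀ i, ∀ x ∈ Icc (0:ℝ) 1, ∀ y ∈ Icc (0:ℝ) 1,
      |f' i x - f' i y| ≤ C * |x - y| ^ αf
  holderg : ∃ C > 0, ∀ i, ∀ x ∈ Icc (0:ℝ) 1, ∀ y ∈ Icc (0:ℝ) 1,
      |g' i x - g' i y| ≤ C * |x - y| ^ αg
  nonzerof : ∀ i, ∀ x ∈ Icc (0:ℝ) 1, f' i x ≠ 0
  nonzerog : ∀ i, ∀ x ∈ Icc (0:ℝ) 1, g' i x ≠ 0
  gridf : ∀ i j, ¬ Disjoint (f i '' Ioo (0:ℝ) 1) (f j '' Ioo (0:ℝ) 1) → f i = f j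
  gridg : ∀ i j, ¬ Disjoint (g i '' Ioo (0:ℝ) 1) (g j '' Ioo (0:ℝ) 1) → g i = g j
  osc : ∀ i j, ¬ Disjoint (f i '' Ioo (0:ℝ) 1) (f j '' Ioo (0:ℝ) 1) →
      ¬ Disjoint (g i '' Ioo (0:ℝ) 1) (g j '' Ioo (0:ℝ) 1) → i = j

variable {I : Type} [Fintype I]

/-- The carpet map `S_w` on `[0,1]²` associated with a finite word `w`. -/
def SMap (S : PCarpetIFS I) (w : List I) : ℝ × ℝ → ℝ × ℝ :=
  fun p => (wMap S.f w p.1, wMap S.g w p.2)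

/-- `ᾱ₁(w) = max_x max{|f_w'(x)|, |g_w'(x)|}`. -/
noncomputable def a1U (S : PCarpetIFS I) (w : List I) : ℝ :=
  ⨆ x : Icc (0:ℝ) 1, max |wDeriv S.f S.f' w x| |wDeriv S.g S.g' w x|

/-- `ᾱ₂(w) = max_x min{|f_w'(x)|, |g_w'(x)|}`. -/
noncomputable def a2U (S : PCarpetIFS I) (w : List I) : ℝ :=
  ⨆ x : Icc (0:ℝ) 1, min |wDeriv S.f S.f' w x| |wDeriv S.g S.g' w x|

/-- `α̲₁(w) = min_x max{|f_w'(x)|, |g_w'(x)|}`. -/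
noncomputable def a1L (S : PCarpetIFS I) (w : List I) : ℝ :=
  ⨅ x : Icc (0:ℝ) 1, max |wDeriv S.f S.f' w x| |wDeriv S.g S.g' w x|

/-- `α̲₂(w) = min_x min{|f_w'(x)|, |g_w'(x)|}`. -/
noncomputable def a2L (S : PCarpetIFS I) (w : List I) : ℝ :=
  ⨅ x : Icc (0:ℝ) 1, min |wDeriv S.f S.f' w x| |wDeriv S.g S.g' w x|

/-- `t(w, q)`: the `L^q`-spectrum of the projection of `μ` onto the coordinate axis in the
direction of the longer side of `S_w([0,1]²)`; `tf` and `tg` are the spectra of the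
projections to the `x`- and `y`-axis respectively. -/
noncomputable def tSel (S : PCarpetIFS I) (tf tg : ℝ → ℝ) (w : List I) (q : ℝ) : ℝ :=
  if Metric.diam (wMap S.g w '' Icc (0:ℝ) 1) ≤ Metric.diam (wMap S.f w '' Icc (0:ℝ) 1)
    then tf q else tg q

/-- The partition sums for the carpet pressure,
`∑_{i ∈ I^n} ℙ([i])^q ᾱ₁(i)^{t(i,q)} ᾱ₂(i)^{s - t(i,q)}`. -/
noncomputable def cSum [MeasurableSpace I] (P : Measure (ℕ → I)) (S : PCarpetIFS I)
    (tf tg : ℝ → ℝ) (n : ℕ) (s q : ℝ) : ℝ :=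
  ∑ w : Fin n → I,
    (P (cyl (List.ofFn w))).toReal ^ q *
      a1U S (List.ofFn w) ^ tSel S tf tg (List.ofFn w) q *
        a2U S (List.ofFn w) ^ (s - tSel S tf tg (List.ofFn w) q)

/-- The `q`-th moment sum of a measure on `ℝ²` over the closed squares of the `δ`-mesh. -/
noncomputable def Dq2 (ν : Measure (ℝ × ℝ)) (q δ : ℝ) : ℝ :=
  ∑' k : ℤ × ℤ,
    pw ((ν (Icc ((k.1 : ℝ) * δ) (((k.1 : ℝ) + 1) * δ) ×ˢ
        Icc ((k.2 : ℝ) * δ) (((k.2 : ℝ) + 1) * δ))).toReal) q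

/-- Number of squares of the `δ`-mesh which intersect `F ⊆ ℝ²`. -/
noncomputable def covCount2 (F : Set (ℝ × ℝ)) (δ : ℝ) : ℕ :=
  Set.ncard {k : ℤ × ℤ |
    ((Icc ((k.1 : ℝ) * δ) (((k.1 : ℝ) + 1) * δ) ×ˢ
      Icc ((k.2 : ℝ) * δ) (((k.2 : ℝ) + 1) * δ)) ∩ F).Nonempty}

/-- The upper box dimension of a subset of `ℝ²` (via mesh squares). -/
noncomputable def ubDim2 (E : Set (ℝ × ℝ)) : ℝ :=
  Filter.limsup (fun δ : ℝ => Real.log (covCount2 E δ) / (-Real.log δ)) (𝓝[>] (0:ℝ))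

/-- The packing dimension of a subset of `ℝ²`, defined (as usual, via the identification of
packing dimension with the modified upper box dimension) as the infimum over countable covers
by bounded sets of the supremal upper box dimension of the pieces. -/
noncomputable def dimP2 (F : Set (ℝ × ℝ)) : ℝ :=
  sInf {a : ℝ | ∃ E : ℕ → Set (ℝ × ℝ), F ⊆ ⋃ n, E n ∧
    ∀ n, Bornology.IsBounded (E n) ∧ ubDim2 (E n) ≤ a}

section CantorSystem

variable {J : Type} [Fintype J] (T : PCantorIFS J)

/-- The length of the interval `h_w([0,1])`. -/
noncomputable def wLen {J : Type} (h : J → ℝ → ℝ) (w : List J) : ℝ :=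
  |wMap h w 0 - wMap h w 1|

/-- The sum of `|h_t([0,1])| ^ β` over the proper suffixes `t` of a word. -/
noncomputable def suffixSum {J : Type} (h : J → ℝ → ℝ) (β : ℝ) : List J → ℝ
  | [] => 0
  | _ :: t => wLen h t ^ β + suffixSum h β t

theorem wMap_map {J K : Type} (c : K → J) (h : J → ℝ → ℝ) (w : List K) :
    wMap h (w.map c) = wMap (h ∘ c) w := by
  induction w with
  | nil => rfl
  | cons a t ih => simp [wMap, ih]

theorem wDeriv_map {J K : Type} (c : K → J) (h h' : J → ℝ → ℝ) (w : List K) :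
    wDeriv h h' (w.map c) = wDeriv (h ∘ c) (h' ∘ c) w := by
  induction w with
  | nil => rfl
  | cons a t ih => simp [wDeriv, wMap_map, ih]

theorem wDeriv_append {J : Type} (h h' : J → ℝ → ℝ) (u v : List J) (x : ℝ) :
    wDeriv h h' (u ++ v) x = wDeriv h h' u (wMap h v x) * wDeriv h h' v x := by
  have hmap : ∀ u : List J, wMap h (u ++ v) x = wMap h u (wMap h v x) := by
    intro u
    induction u with
    | nil => rfl
    | cons a t ih => simp [wMap, ih]
  induction u with
  | nil => simp [wDeriv]
  | cons a t ih => simp [wDeriv, hmap, ih, mul_assoc]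

theorem wMap_mapsTo {J : Type} {h : J → ℝ → ℝ}
    (hmaps : ∀ i, MapsTo (h i) (Icc (0:ℝ) 1) (Icc (0:ℝ) 1)) (w : List J) :
    MapsTo (wMap h w) (Icc (0:ℝ) 1) (Icc (0:ℝ) 1) := by
  induction w with
  | nil => exact mapsTo_id _
  | cons a t ih => exact (hmaps a).comp ih

theorem abs_deriv_le_one_of_contract {φ : ℝ → ℝ} {φ' x : ℝ} (hx : x ∈ Icc (0:ℝ) 1)
    (hφ : ∀ y ∈ Icc (0:ℝ) 1, ∀ z ∈ Icc (0:ℝ) 1, y ≠ z → |φ y - φ z| < |y - z|)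
    (hd : HasDerivWithinAt φ φ' (Icc (0:ℝ) 1) x) : |φ'| ≤ 1 := by
  have hlim := (hasDerivWithinAt_iff_tendsto_slope.1 hd).abs
  have : (𝓝[Icc (0:ℝ) 1 \ {x}] x).NeBot := by
    have := (uniqueDiffOn_Icc (zero_lt_one (α := ℝ)) x hx).accPt
    rwa [accPt_principal_iff_nhdsWithin] at this
  refine le_of_tendsto hlim ?_
  filter_upwards [self_mem_nhdsWithin] with y hy
  have hne : y ≠ x := hy.2
  rw [slope_def_field, abs_div]
  exact (div_lt_one (abs_pos.2 (sub_ne_zero.2 hne))).2 (hφ y hy.1 x hx hne) |>.le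

theorem continuousOn_of_holder {φ : ℝ → ℝ} {C α : ℝ} (hα : 0 < α)
    (hφ : ∀ x ∈ Icc (0:ℝ) 1, ∀ y ∈ Icc (0:ℝ) 1, |φ x - φ y| ≤ C * |x - y| ^ α) :
    ContinuousOn φ (Icc (0:ℝ) 1) := by
  intro x hx
  have hlim : Tendsto (fun y => C * |y - x| ^ α) (𝓝[Icc (0:ℝ) 1] x) (𝓝 0) := by
    have hc : Continuous fun y : ℝ => C * |y - x| ^ α :=
      continuous_const.mul ((continuous_abs.comp (continuous_id.sub continuous_const)).rpow_const
        fun _ => Or.inr hα.le)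
    have := hc.tendsto x
    simp only [sub_self, abs_zero, Real.zero_rpow hα.ne', mul_zero] at this
    exact this.mono_left nhdsWithin_le_nhds
  refine tendsto_iff_dist_tendsto_zero.2 (squeeze_zero' (.of_forall fun _ => dist_nonneg) ?_ hlim)
  filter_upwards [self_mem_nhdsWithin] with y hy
  exact hφ y hy x hx

theorem wMap_continuousOn {J : Type} {h h' : J → ℝ → ℝ}
    (hmaps : ∀ i, MapsTo (h i) (Icc (0:ℝ) 1) (Icc (0:ℝ) 1))
    (hd : ∀ i, ∀ x ∈ Icc (0:ℝ) 1, HasDerivWithinAt (h i) (h' i x) (Icc (0:ℝ) 1) x)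
    (w : List J) : ContinuousOn (wMap h w) (Icc (0:ℝ) 1) := by
  induction w with
  | nil => exact continuousOn_id
  | cons a t ih =>
    exact ContinuousOn.comp (fun x hx => (hd a x hx).continuousWithinAt) ih (wMap_mapsTo hmaps t)

theorem abs_wDeriv_le_one {J : Type} {h h' : J → ℝ → ℝ}
    (hmaps : ∀ i, MapsTo (h i) (Icc (0:ℝ) 1) (Icc (0:ℝ) 1))
    (hle : ∀ i, ∀ x ∈ Icc (0:ℝ) 1, |h' i x| ≤ 1) (w : List J) {x : ℝ} (hx : x ∈ Icc (0:ℝ) 1) :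
    |wDeriv h h' w x| ≤ 1 := by
  induction w with
  | nil => simp [wDeriv]
  | cons a t ih =>
    simp only [wDeriv, abs_mul]
    exact mul_le_one₀ (hle a _ (wMap_mapsTo hmaps t hx)) (abs_nonneg _) ih

/-- By compactness, a pointwise bound on the derivative cocycle is a bound on its supremum. -/
theorem supD_lt_one {J : Type} {h h' : J → ℝ → ℝ}
    (hmaps : ∀ i, MapsTo (h i) (Icc (0:ℝ) 1) (Icc (0:ℝ) 1))
    (hd : ∀ i, ∀ x ∈ Icc (0:ℝ) 1, HasDerivWithinAt (h i) (h' i x) (Icc (0:ℝ) 1) x)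
    (hc : ∀ i, ContinuousOn (h' i) (Icc (0:ℝ) 1)) {w : List J}
    (hw : ∀ x ∈ Icc (0:ℝ) 1, |wDeriv h h' w x| < 1) : supD h h' w < 1 := by
  have hcont : ContinuousOn (wDeriv h h' w) (Icc (0:ℝ) 1) := by
    clear hw
    induction w with
    | nil => exact continuousOn_const
    | cons a t ih =>
      exact ((hc a).comp (wMap_continuousOn hmaps hd t) (wMap_mapsTo hmaps t)).mul ih
  obtain ⟨z, hz, hmax⟩ := isCompact_Icc.exists_isMaxOn (nonempty_Icc.2 zero_le_one) hcont.abs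
  have : Nonempty (Icc (0:ℝ) 1) := ⟨⟨z, hz⟩⟩
  exact (ciSup_le fun x : Icc (0:ℝ) 1 => hmax x.2).trans_lt (hw z hz)

/-- Mean value lower bound. -/
theorem mul_abs_sub_le_of_le_abs_deriv {φ φ' : ℝ → ℝ} {m x y : ℝ}
    (hd : ∀ z ∈ Icc (0:ℝ) 1, HasDerivWithinAt φ (φ' z) (Icc (0:ℝ) 1) z)
    (hx : x ∈ Icc (0:ℝ) 1) (hy : y ∈ Icc (0:ℝ) 1) (hm : ∀ z ∈ uIcc x y, m ≤ |φ' z|) :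
    m * |x - y| ≤ |φ x - φ y| := by
  wlog hxy : x < y generalizing x y
  · rcases (not_lt.1 hxy).eq_or_lt with h | h
    · simp [h]
    · rw [abs_sub_comm x, abs_sub_comm (φ x)]
      exact this hy hx (by rwa [uIcc_comm]) h
  have hsub : Icc x y ⊆ Icc (0:ℝ) 1 := Icc_subset_Icc hx.1 hy.2
  obtain ⟨z, hz, hslope⟩ := exists_hasDerivAt_eq_slope φ φ' hxy
    (fun z hz => ((hd z (hsub hz)).continuousWithinAt).mono hsub)
    (fun z hz => (hd z (hsub (Ioo_subset_Icc_self hz))).hasDerivAt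
      (Icc_mem_nhds (hx.1.trans_lt hz.1) (hz.2.trans_le hy.2)))
  have hz' := hm z (by rw [uIcc_of_le hxy.le]; exact Ioo_subset_Icc_self hz)
  have hpos : 0 < |y - x| := abs_pos.2 (sub_ne_zero.2 hxy.ne')
  rw [hslope, abs_div, le_div_iff₀ hpos] at hz'
  rwa [abs_sub_comm x, abs_sub_comm (φ x)]

namespace PCantorIFS

theorem deriv_continuousOn (i : J) : ContinuousOn (T.h' i) (Icc (0:ℝ) 1) := by
  obtain ⟨C, -, hC⟩ := T.holder
  exact continuousOn_of_holder T.αh_pos (hC i)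

theorem abs_deriv_le_one (i : J) {x : ℝ} (hx : x ∈ Icc (0:ℝ) 1) : |T.h' i x| ≤ 1 :=
  abs_deriv_le_one_of_contract hx (T.contract i) (T.hasDeriv i x hx)

theorem exists_pos_le_abs_deriv : ∃ c > 0, ∀ i, ∀ x ∈ Icc (0:ℝ) 1, c ≤ |T.h' i x| := by
  have hmin : ∀ i, ∃ z ∈ Icc (0:ℝ) 1, IsMinOn (fun x => |T.h' i x|) (Icc 0 1) z := fun i =>
    isCompact_Icc.exists_isMinOn (nonempty_Icc.2 zero_le_one) (T.deriv_continuousOn i).abs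
  choose z hz hzmin using hmin
  have : Nonempty J := Fintype.card_pos_iff.1 (by have := T.card; omega)
  obtain ⟨i₀, hi₀⟩ := Finite.exists_min fun i => |T.h' i (z i)|
  exact ⟨_, abs_pos.2 (T.nonzero i₀ _ (hz i₀)), fun i x hx => (hi₀ i).trans (hzmin i hx)⟩

theorem injOn_s3 (i : J) : InjOn (T.h i) (Icc (0:ℝ) 1) := by
  obtain ⟨c, hc, hle⟩ := T.exists_pos_le_abs_deriv
  intro x hx y hy hxy
  have := mul_abs_sub_le_of_le_abs_deriv (T.hasDeriv i) hx hy
    fun z hz => hle i z (uIcc_subset_Icc hx hy hz)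
  rw [hxy, sub_self, abs_zero] at this
  exact sub_eq_zero.1 (abs_eq_zero.1 (le_antisymm (by nlinarith) (abs_nonneg _)))

theorem wMap_injOn (w : List J) : InjOn (wMap T.h w) (Icc (0:ℝ) 1) := by
  induction w with
  | nil => exact injOn_id _
  | cons a t ih => exact (T.injOn_s3 a).comp ih (wMap_mapsTo T.maps t)

theorem strictMonoOn_or_strictAntiOn (w : List J) :
    StrictMonoOn (wMap T.h w) (Icc (0:ℝ) 1) ∨ StrictAntiOn (wMap T.h w) (Icc (0:ℝ) 1) :=
  (wMap_continuousOn T.maps T.hasDeriv w).strictMonoOn_of_injOn_Icc' zero_le_one (T.wMap_injOn w)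

theorem wMap_mem_uIcc (w : List J) {x : ℝ} (hx : x ∈ Icc (0:ℝ) 1) :
    wMap T.h w x ∈ uIcc (wMap T.h w 0) (wMap T.h w 1) := by
  have h0 : (0:ℝ) ∈ Icc (0:ℝ) 1 := by simp
  have h1 : (1:ℝ) ∈ Icc (0:ℝ) 1 := by simp
  rcases T.strictMonoOn_or_strictAntiOn w with h | h
  · exact mem_uIcc.2 (.inl ⟨h.monotoneOn h0 hx hx.1, h.monotoneOn hx h1 hx.2⟩)
  · exact mem_uIcc.2 (.inr ⟨h.antitoneOn hx h1 hx.2, h.antitoneOn h0 hx hx.1⟩)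

theorem wMap_mapsTo_Ioo (w : List J) : MapsTo (wMap T.h w) (Ioo (0:ℝ) 1) (Ioo (0:ℝ) 1) := by
  have h0 : (0:ℝ) ∈ Icc (0:ℝ) 1 := by simp
  have h1 : (1:ℝ) ∈ Icc (0:ℝ) 1 := by simp
  have m0 := wMap_mapsTo T.maps w h0
  have m1 := wMap_mapsTo T.maps w h1
  intro x hx
  have hx' := Ioo_subset_Icc_self hx
  rcases T.strictMonoOn_or_strictAntiOn w with h | h
  · exact ⟨m0.1.trans_lt (h h0 hx' hx.1), (h hx' h1 hx.2).trans_le m1.2⟩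
  · exact ⟨m1.1.trans_lt (h hx' h1 hx.2), (h h0 hx' hx.1).trans_le m0.2⟩

theorem uIoo_subset_image (w : List J) :
    uIoo (wMap T.h w 0) (wMap T.h w 1) ⊆ wMap T.h w '' Ioo (0:ℝ) 1 := by
  have hc := wMap_continuousOn T.maps T.hasDeriv w
  rcases le_total (wMap T.h w 0) (wMap T.h w 1) with h | h
  · rw [uIoo_of_le h]
    exact intermediate_value_Ioo zero_le_one hc
  · rw [uIoo_of_ge h]
    exact intermediate_value_Ioo' zero_le_one hc

theorem disjoint_image_Ioo : ∀ (v w : List J), v.length = w.length → v ≠ w →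
    Disjoint (wMap T.h v '' Ioo (0:ℝ) 1) (wMap T.h w '' Ioo (0:ℝ) 1)
  | [], [], _, hne => (hne rfl).elim
  | a :: s, b :: t, hlen, hne => by
    simp only [wMap, image_comp]
    have hs := (T.wMap_mapsTo_Ioo s).image_subset
    have ht := (T.wMap_mapsTo_Ioo t).image_subset
    by_cases hab : a = b
    · subst hab
      have hst : s ≠ t := fun h => hne (by rw [h])
      rw [disjoint_iff_inter_eq_empty, ← (T.injOn_s3 a).image_inter (hs.trans Ioo_subset_Icc_self)
        (ht.trans Ioo_subset_Icc_self), (disjoint_image_Ioo s t (by simpa using hlen) hst).inter_eq,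
        image_empty]
    · exact (T.sep a b hab).mono (image_mono hs) (image_mono ht)

theorem sum_wLen_le_one (n : ℕ) : ∑ w : Fin n → J, wLen T.h (List.ofFn w) ≤ 1 := by
  let U : (Fin n → J) → Set ℝ := fun w =>
    uIoo (wMap T.h (List.ofFn w) 0) (wMap T.h (List.ofFn w) 1)
  have hvol : ∀ w, volume (U w) = ENNReal.ofReal (wLen T.h (List.ofFn w)) := fun w => by
    simp only [U, uIoo, Real.volume_Ioo, wLen, max_sub_min_eq_abs]
    rw [abs_sub_comm]
  have hdisj : Pairwise (Function.onFun Disjoint U) := fun v w hvw =>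
    (T.disjoint_image_Ioo _ _ (by simp) fun h => hvw (List.ofFn_injective h)).mono
      (T.uIoo_subset_image _) (T.uIoo_subset_image _)
  have hsub : (⋃ w, U w) ⊆ Ioo (0:ℝ) 1 := iUnion_subset fun w =>
    (T.uIoo_subset_image _).trans (T.wMap_mapsTo_Ioo _).image_subset
  have hle : ∑ w, volume (U w) ≤ 1 := by
    rw [← tsum_fintype (L := .unconditional _), ← measure_iUnion hdisj fun w => measurableSet_Ioo]
    simpa using measure_mono (μ := volume) hsub
  simp only [hvol] at hle
  rwa [← ENNReal.ofReal_sum_of_nonneg (f := fun w : Fin n → J => wLen T.h (List.ofFn w))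
    fun w _ => abs_nonneg _, ENNReal.ofReal_le_one] at hle

theorem wLen_le_one (w : List J) : wLen T.h w ≤ 1 := by
  have h0 := wMap_mapsTo T.maps w (show (0:ℝ) ∈ Icc (0:ℝ) 1 by simp)
  have h1 := wMap_mapsTo T.maps w (show (1:ℝ) ∈ Icc (0:ℝ) 1 by simp)
  exact abs_le.2 ⟨by linarith [h0.1, h1.2], by linarith [h0.2, h1.1]⟩

/-- Bernoulli's inequality bounds the sums of the `β`-th powers of the lengths of cylinders. -/
theorem sum_wLen_rpow_le {β : ℝ} (hβ : 0 ≤ β) (hβ1 : β ≤ 1) (n : ℕ) :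
    ∑ w : Fin n → J, wLen T.h (List.ofFn w) ^ β
      ≤ (Fintype.card J : ℝ) ^ n * (((Fintype.card J : ℝ) ^ β)⁻¹) ^ n := by
  set N : ℝ := (Fintype.card J : ℝ) ^ n with hN
  have hk : (0:ℝ) < Fintype.card J := by exact_mod_cast (by have := T.card; omega)
  have hNpos : 0 < N := by positivity
  have hNβ : (((Fintype.card J : ℝ) ^ β)⁻¹) ^ n = (N ^ β)⁻¹ := by
    rw [inv_pow, ← Real.rpow_natCast, ← Real.rpow_mul hk.le, mul_comm, Real.rpow_mul hk.le,
      Real.rpow_natCast]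
  rw [hNβ, ← div_eq_mul_inv, le_div_iff₀ (by positivity), Finset.sum_mul]
  calc ∑ w : Fin n → J, wLen T.h (List.ofFn w) ^ β * N ^ β
      ≤ ∑ w : Fin n → J, (1 + β * (wLen T.h (List.ofFn w) * N - 1)) := by
        refine Finset.sum_le_sum fun w _ => ?_
        have hw : 0 ≤ wLen T.h (List.ofFn w) := abs_nonneg _
        rw [← Real.mul_rpow hw hNpos.le]
        have := rpow_one_add_le_one_add_mul_self
          (s := wLen T.h (List.ofFn w) * N - 1) (by nlinarith [mul_nonneg hw hNpos.le]) hβ hβ1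
        simpa using this
    _ = N + β * N * (∑ w : Fin n → J, wLen T.h (List.ofFn w) - 1) := by
        rw [Finset.sum_add_distrib, ← Finset.mul_sum, Finset.sum_sub_distrib, ← Finset.sum_mul]
        simp only [Finset.sum_const, Finset.card_univ, Fintype.card_fun, Fintype.card_fin,
          nsmul_eq_mul, Nat.cast_pow, mul_one, ← hN]
        ring
    _ ≤ N := by
        have := T.sum_wLen_le_one n
        have h2 : 0 ≤ β * N := by positivity
        nlinarith

theorem sum_suffixSum_le {β : ℝ} (hβ : 0 ≤ β) (hβ1 : β ≤ 1) (n : ℕ) :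
    ∑ w : Fin n → J, suffixSum T.h β (List.ofFn w)
      ≤ (Fintype.card J : ℝ) ^ n *
        ∑ m ∈ Finset.range n, (((Fintype.card J : ℝ) ^ β)⁻¹) ^ m := by
  induction n with
  | zero => simp [suffixSum]
  | succ n ih =>
    have hcons : ∀ p : J × (Fin n → J),
        suffixSum T.h β (List.ofFn (Fin.consEquiv (fun _ => J) p))
          = wLen T.h (List.ofFn p.2) ^ β + suffixSum T.h β (List.ofFn p.2) := fun p => by
      simp [List.ofFn_succ, suffixSum, Fin.consEquiv]
    rw [← (Fin.consEquiv fun _ => J).sum_comp, Finset.sum_congr rfl fun p _ => hcons p,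
      Fintype.sum_prod_type]
    simp only [Finset.sum_add_distrib, Finset.sum_const, Finset.card_univ, nsmul_eq_mul]
    rw [Finset.sum_range_succ, ← mul_add, pow_succ', mul_assoc]
    gcongr
    rw [mul_add, add_comm]
    exact add_le_add ih (T.sum_wLen_rpow_le hβ hβ1 n)

/-- If no word is hyperbolic then the length of each cylinder is comparable to that of its
proper suffix, with an error controlled by Hölder continuity. -/
theorem exists_exp_le_wLen (hno : ∀ w : List J, ∃ x ∈ Icc (0:ℝ) 1, 1 ≤ |wDeriv T.h T.h' w x|) :
    ∃ K > 0, ∀ w : List J,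
      Real.exp (-(K * suffixSum T.h (min T.αh 1) w)) ≤ wLen T.h w := by
  obtain ⟨C, hC, hholder⟩ := T.holder
  obtain ⟨c, hc, hle⟩ := T.exists_pos_le_abs_deriv
  refine ⟨C / c, by positivity, fun w => ?_⟩
  induction w with
  | nil => simp [suffixSum, wLen, wMap]
  | cons a t ih =>
    set β := min T.αh 1
    set d := wLen T.h t with hd
    have h0 := wMap_mapsTo T.maps t (show (0:ℝ) ∈ Icc (0:ℝ) 1 by simp)
    have h1 := wMap_mapsTo T.maps t (show (1:ℝ) ∈ Icc (0:ℝ) 1 by simp)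
    obtain ⟨x, hx, hx1⟩ := hno (a :: t)
    have hz := wMap_mapsTo T.maps t hx
    have hz1 : 1 ≤ |T.h' a (wMap T.h t x)| := by
      rw [wDeriv, abs_mul] at hx1
      exact hx1.trans (mul_le_of_le_one_right (abs_nonneg _)
        (abs_wDeriv_le_one T.maps (fun i y hy => T.abs_deriv_le_one i hy) t hx))
    have hlow : ∀ y ∈ uIcc (wMap T.h t 0) (wMap T.h t 1),
        Real.exp (-(C / c * d ^ β)) ≤ |T.h' a y| := by
      intro y hy
      have hy' := uIcc_subset_Icc h0 h1 hy
      have hpos : 0 < |T.h' a y| := hc.trans_le (hle a y hy')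
      have hdist : |wMap T.h t x - y| ≤ d := by
        rw [hd, wLen, abs_sub_comm (wMap T.h t 0)]
        exact abs_sub_le_of_uIcc_subset_uIcc
          (uIcc_subset_uIcc hy (T.wMap_mem_uIcc t hx))
      have hpow : |wMap T.h t x - y| ^ T.αh ≤ d ^ β := by
        have hd1 : d ≤ 1 := T.wLen_le_one t
        calc |wMap T.h t x - y| ^ T.αh ≤ d ^ T.αh :=
              Real.rpow_le_rpow (abs_nonneg _) hdist T.αh_pos.le
          _ ≤ d ^ β := Real.rpow_le_rpow_of_exponent_ge' (abs_nonneg _) hd1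
              (lt_min T.αh_pos one_pos).le (min_le_left _ _)
      have hdiff : 1 - |T.h' a y| ≤ C * d ^ β := by
        have h1 := hholder a _ hz y hy'
        have h2 := abs_sub_abs_le_abs_sub (T.h' a (wMap T.h t x)) (T.h' a y)
        have h3 := mul_le_mul_of_nonneg_left hpow hC.le
        linarith
      rw [← Real.le_log_iff_exp_le hpos]
      refine le_trans ?_ (Real.one_sub_inv_le_log_of_pos hpos)
      have hdβ : 0 ≤ C * d ^ β := mul_nonneg hC.le (Real.rpow_nonneg (abs_nonneg _) _)
      have : |T.h' a y|⁻¹ - 1 ≤ C * d ^ β / c := by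
        rw [show |T.h' a y|⁻¹ - 1 = (1 - |T.h' a y|) / |T.h' a y| by field_simp]
        exact div_le_div₀ hdβ hdiff hc (hle a y hy')
      rw [div_mul_eq_mul_div]
      linarith
    calc Real.exp (-(C / c * suffixSum T.h β (a :: t)))
        = Real.exp (-(C / c * d ^ β)) * Real.exp (-(C / c * suffixSum T.h β t)) := by
          rw [← Real.exp_add, suffixSum, ← hd, mul_add, neg_add]
      _ ≤ Real.exp (-(C / c * d ^ β)) * d := by gcongr
      _ ≤ wLen T.h (a :: t) := mul_abs_sub_le_of_le_abs_deriv (T.hasDeriv a) h0 h1 hlow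

/-- A parabolic Cantor set system has a hyperbolic word. -/
theorem exists_hyperbolic_word :
    ∃ w : List J, ∀ x ∈ Icc (0:ℝ) 1, |wDeriv T.h T.h' w x| < 1 := by
  by_contra! hno
  obtain ⟨K, hK, hexp⟩ := T.exists_exp_le_wLen hno
  set β := min T.αh 1
  have hβ : 0 < β := lt_min T.αh_pos one_pos
  have hk : (1:ℝ) < Fintype.card J := by exact_mod_cast (by have := T.card; omega)
  set r : ℝ := ((Fintype.card J : ℝ) ^ β)⁻¹
  have hr0 : 0 ≤ r := by positivity
  have hr1 : r < 1 := inv_lt_one_of_one_lt₀ (Real.one_lt_rpow hk hβ)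
  set B : ℝ := (1 - r)⁻¹
  have hbound : ∀ n : ℕ, (Fintype.card J : ℝ) ^ n ≤ Real.exp (K * B) := by
    intro n
    have hsum : ∑ w : Fin n → J, suffixSum T.h β (List.ofFn w) ≤ (Fintype.card J : ℝ) ^ n * B := by
      refine (T.sum_suffixSum_le hβ.le (min_le_right _ _) n).trans ?_
      gcongr
      exact (summable_geometric_of_lt_one hr0 hr1).sum_le_tsum _ (fun _ _ => by positivity)
        |>.trans_eq (tsum_geometric_of_lt_one hr0 hr1)
    have htangent : ∀ w : Fin n → J,
        1 + (K * B - K * suffixSum T.h β (List.ofFn w))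
          ≤ Real.exp (K * B) * wLen T.h (List.ofFn w) := fun w =>
      calc 1 + (K * B - K * suffixSum T.h β (List.ofFn w))
          ≤ Real.exp (K * B + -(K * suffixSum T.h β (List.ofFn w))) := by
            rw [← sub_eq_add_neg, add_comm]
            exact Real.add_one_le_exp _
        _ ≤ _ := by
            rw [Real.exp_add]
            exact mul_le_mul_of_nonneg_left (hexp _) (Real.exp_pos _).le
    have := Finset.sum_le_sum fun w (_ : w ∈ Finset.univ) => htangent w
    rw [Finset.sum_add_distrib, Finset.sum_sub_distrib, ← Finset.mul_sum, ← Finset.mul_sum,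
      ← Finset.mul_sum] at this
    simp only [Finset.sum_const, Finset.card_univ, Fintype.card_fun, Fintype.card_fin,
      nsmul_eq_mul, Nat.cast_pow, mul_one] at this
    have h1 := mul_le_mul_of_nonneg_left (T.sum_wLen_le_one n) (Real.exp_pos (K * B)).le
    have h2 := mul_le_mul_of_nonneg_left hsum hK.le
    nlinarith
  obtain ⟨n, hn⟩ := pow_unbounded_of_one_lt (Real.exp (K * B)) hk
  exact (hbound n).not_gt hn

end PCantorIFS

/-- A pair of letters acting with disjoint images generates a parabolic Cantor set system, and
hence a hyperbolic word. -/
theorem exists_hyperbolic_word_of_disjoint {J : Type} {h h' : J → ℝ → ℝ} {α : ℝ} (hα : 0 < α)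
    (hmaps : ∀ i, MapsTo (h i) (Icc (0:ℝ) 1) (Icc (0:ℝ) 1))
    (hcontr : ∀ i, ∀ x ∈ Icc (0:ℝ) 1, ∀ y ∈ Icc (0:ℝ) 1, x ≠ y → |h i x - h i y| < |x - y|)
    (hderiv : ∀ i, ∀ x ∈ Icc (0:ℝ) 1, HasDerivWithinAt (h i) (h' i x) (Icc (0:ℝ) 1) x)
    (hholder : ∃ C > 0, ∀ i, ∀ x ∈ Icc (0:ℝ) 1, ∀ y ∈ Icc (0:ℝ) 1,
      |h' i x - h' i y| ≤ C * |x - y| ^ α)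
    (hne : ∀ i, ∀ x ∈ Icc (0:ℝ) 1, h' i x ≠ 0)
    {i j : J} (hij : Disjoint (h i '' Ioo (0:ℝ) 1) (h j '' Ioo (0:ℝ) 1)) :
    ∃ w : List J, ∀ x ∈ Icc (0:ℝ) 1, |wDeriv h h' w x| < 1 := by
  obtain ⟨C, hC, hholder⟩ := hholder
  let c : Bool → J := fun b => cond b i j
  let T : PCantorIFS Bool :=
    { h := h ∘ c
      h' := h' ∘ c
      αh := α
      αh_pos := hα
      card := by simp
      maps := fun b => hmaps (c b)
      contract := fun b => hcontr (c b)
      hasDeriv := fun b => hderiv (c b)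
      holder := ⟨C, hC, fun b => hholder (c b)⟩
      nonzero := fun b => hne (c b)
      sep := by
        rintro (_ | _) (_ | _) hb
        · exact absurd rfl hb
        · exact hij.symm
        · exact hij
        · exact absurd rfl hb }
  obtain ⟨w, hw⟩ := T.exists_hyperbolic_word
  exact ⟨w.map c, fun x hx => by rw [wDeriv_map]; exact hw x hx⟩

theorem wMap_ofFn_congr {J : Type} {h : J → ℝ → ℝ} (heq : ∀ i j, h i = h j) (n : ℕ)
    (v w : Fin n → J) : wMap h (List.ofFn v) = wMap h (List.ofFn w) := by
  induction n with
  | zero => simp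
  | succ n ih =>
    simp only [List.ofFn_succ, wMap]
    rw [heq (v 0) (w 0), ih]

end CantorSystem

/-- If a parabolic carpet is not contained in a vertical or horizontal line,
then the semigroup generated by the IFS contains a word `i₀` which is uniformly hyperbolic in
both coordinates. -/
theorem exists_hyperbolic_word_carpet {I : Type} [Fintype I]
    (S : PCarpetIFS I)
    (Pi : (ℕ → I) → ℝ × ℝ)
    (hPi : ∀ ω : ℕ → I,
      (⋂ n : ℕ, SMap S (List.ofFn fun k : Fin n => ω k) '' (Icc (0:ℝ) 1 ×ˢ Icc (0:ℝ) 1))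
        = {Pi ω})
    (hline1 : ¬ ∃ a : ℝ, ∀ ω : ℕ → I, (Pi ω).1 = a)
    (hline2 : ¬ ∃ b : ℝ, ∀ ω : ℕ → I, (Pi ω).2 = b) :
    ∃ u : List I, u ≠ [] ∧ supD S.f S.f' u < 1 ∧ supD S.g S.g' u < 1 := by
  have hf : ∃ i j, S.f i ≠ S.f j := by
    by_contra! heq
    obtain ⟨i₀⟩ : Nonempty I := Fintype.card_pos_iff.1 (by have := S.card; omega)
    refine hline1 ⟨(Pi fun _ => i₀).1, fun ω => ?_⟩
    have hmem : ((Pi fun _ => i₀).1, (Pi ω).2) ∈ ({Pi ω} : Set (ℝ × ℝ)) := by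
      rw [← hPi ω, mem_iInter]
      intro n
      have h1 := mem_iInter.1 ((hPi ω).ge rfl) n
      have h2 := mem_iInter.1 ((hPi fun _ => i₀).ge rfl) n
      obtain ⟨p, hp, hp'⟩ := h1
      obtain ⟨q, hq, hq'⟩ := h2
      refine ⟨(q.1, p.2), ⟨hq.1, hp.2⟩, ?_⟩
      rw [← hp', ← hq']
      exact Prod.ext (congrFun (wMap_ofFn_congr heq n _ _) q.1) rfl
    exact (congrArg Prod.fst hmem).symm
  have hg : ∃ i j, S.g i ≠ S.g j := by
    by_contra! heq
    obtain ⟨i₀⟩ : Nonempty I := Fintype.card_pos_iff.1 (by have := S.card; omega)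
    refine hline2 ⟨(Pi fun _ => i₀).2, fun ω => ?_⟩
    have hmem : ((Pi ω).1, (Pi fun _ => i₀).2) ∈ ({Pi ω} : Set (ℝ × ℝ)) := by
      rw [← hPi ω, mem_iInter]
      intro n
      have h1 := mem_iInter.1 ((hPi ω).ge rfl) n
      have h2 := mem_iInter.1 ((hPi fun _ => i₀).ge rfl) n
      obtain ⟨p, hp, hp'⟩ := h1
      obtain ⟨q, hq, hq'⟩ := h2
      refine ⟨(p.1, q.2), ⟨hp.1, hq.2⟩, ?_⟩
      rw [← hp', ← hq']
      exact Prod.ext rfl (congrFun (wMap_ofFn_congr heq n _ _) q.2)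
    exact (congrArg Prod.snd hmem).symm
  obtain ⟨i, j, hij⟩ := hf
  obtain ⟨k, l, hkl⟩ := hg
  obtain ⟨u, hu⟩ := exists_hyperbolic_word_of_disjoint S.αf_pos S.mapsf S.contractf S.hasDerivf
    S.holderf S.nonzerof (not_not.1 fun h => hij (S.gridf i j h))
  obtain ⟨v, hv⟩ := exists_hyperbolic_word_of_disjoint S.αg_pos S.mapsg S.contractg S.hasDerivg
    S.holderg S.nonzerog (not_not.1 fun h => hkl (S.gridg k l h))
  have hfle : ∀ i, ∀ x ∈ Icc (0:ℝ) 1, |S.f' i x| ≤ 1 := fun i x hx =>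
    abs_deriv_le_one_of_contract hx (S.contractf i) (S.hasDerivf i x hx)
  have hgle : ∀ i, ∀ x ∈ Icc (0:ℝ) 1, |S.g' i x| ≤ 1 := fun i x hx =>
    abs_deriv_le_one_of_contract hx (S.contractg i) (S.hasDerivg i x hx)
  obtain ⟨Cf, -, hCf⟩ := S.holderf
  obtain ⟨Cg, -, hCg⟩ := S.holderg
  refine ⟨u ++ v, ?_, ?_, ?_⟩
  · intro h
    have := hu 0 (by simp)
    simp [(List.append_eq_nil_iff.1 h).1, wDeriv] at this
  · refine supD_lt_one S.mapsf S.hasDerivf (fun i => continuousOn_of_holder S.αf_pos (hCf i))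
      fun x hx => ?_
    rw [wDeriv_append, abs_mul]
    exact mul_lt_one_of_nonneg_of_lt_one_left (abs_nonneg _) (hu _ (wMap_mapsTo S.mapsf v hx))
      (abs_wDeriv_le_one S.mapsf hfle v hx)
  · refine supD_lt_one S.mapsg S.hasDerivg (fun i => continuousOn_of_holder S.αg_pos (hCg i))
      fun x hx => ?_
    rw [wDeriv_append, abs_mul]
    exact mul_lt_one_of_nonneg_of_lt_one_right
      (abs_wDeriv_le_one S.mapsg hgle u (wMap_mapsTo S.mapsg v hx)) (abs_nonneg _) (hv x hx)
end

section
/- Let {h_i}_{i∈I} be an IFS generating a parabolic Cantor set. Then there exists a sequence (p_n) with p_n → 0 such that for all n, all x, y ∈ [0,1] and all words i ∈ I^n, |h_i'(x)| ≤ e^{n p_n} |h_i'(y)|; moreover (p_n) can be chosen so that n ↦ e^{n p_n} is non-decreasing. -/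
open Set Filter MeasureTheory Metric Topology
open scoped ENNReal NNReal

namespace PCantorIFS

variable {I : Type} [Fintype I] (S : PCantorIFS I)

lemma continuousOn_h (i : I) : ContinuousOn (S.h i) (Icc (0:ℝ) 1) :=
  fun x hx => (S.hasDeriv i x hx).continuousWithinAt

lemma continuousOn_h' (i : I) : ContinuousOn (S.h' i) (Icc (0:ℝ) 1) := by
  obtain ⟨C, -, hC⟩ := S.holder
  intro x hx
  have hlim : Tendsto (fun y => C * |y - x| ^ S.αh) (𝓝[Icc (0:ℝ) 1] x) (𝓝 0) := by
    have hcont : Continuous fun y : ℝ => C * |y - x| ^ S.αh :=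
      continuous_const.mul
        ((continuous_id.sub continuous_const).abs.rpow_const fun _ => Or.inr S.αh_pos.le)
    have h0 := hcont.tendsto x
    simp only [sub_self, abs_zero, Real.zero_rpow S.αh_pos.ne', mul_zero] at h0
    exact h0.mono_left nhdsWithin_le_nhds
  refine tendsto_iff_dist_tendsto_zero.2 (squeeze_zero' ?_ ?_ hlim)
  · exact Eventually.of_forall fun y => dist_nonneg
  · filter_upwards [self_mem_nhdsWithin] with y hy
    exact hC i y hy x hx

lemma continuousOn_log_abs_h' (i : I) :
    ContinuousOn (fun x => Real.log |S.h' i x|) (Icc (0:ℝ) 1) :=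
  (S.continuousOn_h' i).abs.log fun x hx => abs_ne_zero.2 (S.nonzero i x hx)

lemma abs_h_sub_le (i : I) {x y : ℝ} (hx : x ∈ Icc (0:ℝ) 1) (hy : y ∈ Icc (0:ℝ) 1) :
    |S.h i x - S.h i y| ≤ |x - y| := by
  rcases eq_or_ne x y with rfl | hne
  · simp
  · exact (S.contract i x hx y hy hne).le

/-- At every positive scale `ε`, the maps contract uniformly. -/
lemma exists_uniform_contraction {ε : ℝ} (hε : 0 < ε) :
    ∃ r : ℝ, 0 < r ∧ r < 1 ∧ ∀ i, ∀ x ∈ Icc (0:ℝ) 1, ∀ y ∈ Icc (0:ℝ) 1,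
      |S.h i x - S.h i y| ≤ max ε (r * |x - y|) := by
  have key : ∀ i, ∀ᶠ r in 𝓝[<] (1:ℝ), ∀ x ∈ Icc (0:ℝ) 1, ∀ y ∈ Icc (0:ℝ) 1,
      |S.h i x - S.h i y| ≤ max ε (r * |x - y|) := by
    intro i
    set K : Set (ℝ × ℝ) := (Icc (0:ℝ) 1 ×ˢ Icc (0:ℝ) 1) ∩ {p | ε ≤ |p.1 - p.2|} with hK
    have hKc : IsCompact K := (isCompact_Icc.prod isCompact_Icc).inter_right
      (isClosed_le continuous_const (by fun_prop))
    have hpos : ∀ p ∈ K, 0 < |p.1 - p.2| := fun p hp => hε.trans_le hp.2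
    have hcont : ContinuousOn (fun p : ℝ × ℝ => |S.h i p.1 - S.h i p.2| / |p.1 - p.2|) K := by
      refine ContinuousOn.div ?_ (by fun_prop) fun p hp => (hpos p hp).ne'
      exact (((S.continuousOn_h i).comp continuousOn_fst fun p hp => hp.1.1).sub
        ((S.continuousOn_h i).comp continuousOn_snd fun p hp => hp.1.2)).abs
    obtain ⟨r₀, hr₀, hr⟩ : ∃ r₀ < (1:ℝ), ∀ p ∈ K,
        |S.h i p.1 - S.h i p.2| / |p.1 - p.2| ≤ r₀ := by
      rcases K.eq_empty_or_nonempty with he | hne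
      · exact ⟨0, zero_lt_one, by simp [he]⟩
      · obtain ⟨q, hq, hmax⟩ := hKc.exists_isMaxOn hne hcont
        refine ⟨_, ?_, hmax⟩
        rw [div_lt_one (hpos q hq)]
        exact S.contract i _ hq.1.1 _ hq.1.2 (sub_ne_zero.1 (abs_pos.1 (hpos q hq)))
    filter_upwards [Ioo_mem_nhdsLT hr₀] with r hr₁ x hx y hy
    rcases lt_or_ge |x - y| ε with hlt | hge
    · exact le_max_of_le_left ((S.abs_h_sub_le i hx hy).trans hlt.le)
    · have hp : (x, y) ∈ K := ⟨⟨hx, hy⟩, hge⟩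
      have h1 := hr _ hp
      rw [div_le_iff₀ (hpos _ hp)] at h1
      exact le_max_of_le_right
        (h1.trans (mul_le_mul_of_nonneg_right hr₁.1.le (abs_nonneg _)))
  obtain ⟨r, hr, hr₁⟩ := ((eventually_all.2 key).and (Ioo_mem_nhdsLT zero_lt_one)).exists
  exact ⟨r, hr₁.1, hr₁.2, hr⟩

lemma wMap_mem (w : List I) {x : ℝ} (hx : x ∈ Icc (0:ℝ) 1) : wMap S.h w x ∈ Icc (0:ℝ) 1 := by
  induction w with
  | nil => exact hx
  | cons a t ih => exact S.maps a ih

/-- The images of `[0,1]` under long words are uniformly small. -/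
lemma exists_abs_wMap_sub_le {ε : ℝ} (hε : 0 < ε) :
    ∃ N : ℕ, ∀ w : List I, N ≤ w.length → ∀ x ∈ Icc (0:ℝ) 1, ∀ y ∈ Icc (0:ℝ) 1,
      |wMap S.h w x - wMap S.h w y| ≤ ε := by
  obtain ⟨r, hr0, hr1, hr⟩ := S.exists_uniform_contraction hε
  have key : ∀ w : List I, ∀ x ∈ Icc (0:ℝ) 1, ∀ y ∈ Icc (0:ℝ) 1,
      |wMap S.h w x - wMap S.h w y| ≤ max ε (r ^ w.length) := by
    intro w x hx y hy
    induction w with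
    | nil =>
      refine le_max_of_le_right ?_
      simp only [wMap, id, List.length_nil, pow_zero, abs_le]
      constructor <;> linarith [hx.1, hx.2, hy.1, hy.2]
    | cons a t ih =>
      refine (hr a _ (S.wMap_mem t hx) _ (S.wMap_mem t hy)).trans (max_le (le_max_left _ _) ?_)
      refine (mul_le_mul_of_nonneg_left ih hr0.le).trans ?_
      rw [mul_max_of_nonneg _ _ hr0.le, List.length_cons, pow_succ']
      exact max_le_max_right _ (mul_le_of_le_one_left hε.le hr1.le)
  obtain ⟨N, hN⟩ := exists_pow_lt_of_lt_one hε hr1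
  refine ⟨N, fun w hw x hx y hy => (key w x hx y hy).trans (max_le le_rfl ?_)⟩
  exact (pow_le_pow_of_le_one hr0.le hr1.le hw).trans hN.le

lemma wDeriv_ne_zero (w : List I) {x : ℝ} (hx : x ∈ Icc (0:ℝ) 1) :
    wDeriv S.h S.h' w x ≠ 0 := by
  induction w with
  | nil => exact one_ne_zero
  | cons a t ih => exact mul_ne_zero (S.nonzero a _ (S.wMap_mem t hx)) ih

lemma log_abs_wDeriv_cons (a : I) (t : List I) {x : ℝ} (hx : x ∈ Icc (0:ℝ) 1) :
    Real.log |wDeriv S.h S.h' (a :: t) x| =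
      Real.log |S.h' a (wMap S.h t x)| + Real.log |wDeriv S.h S.h' t x| := by
  rw [wDeriv, abs_mul, Real.log_mul (abs_ne_zero.2 (S.nonzero a _ (S.wMap_mem t hx)))
    (abs_ne_zero.2 (S.wDeriv_ne_zero t hx))]

/-- The logarithmic distortion grows sublinearly in the word length. -/
lemma exists_log_distortion_le {η : ℝ} (hη : 0 < η) :
    ∃ C : ℝ, 0 ≤ C ∧ ∀ w : List I, ∀ x ∈ Icc (0:ℝ) 1, ∀ y ∈ Icc (0:ℝ) 1,
      Real.log |wDeriv S.h S.h' w x| - Real.log |wDeriv S.h S.h' w y| ≤ C + w.length * η := by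
  have hunif : ∀ i, ∀ᶠ δ in 𝓝[>] (0:ℝ), ∀ x ∈ Icc (0:ℝ) 1, ∀ y ∈ Icc (0:ℝ) 1, |x - y| ≤ δ →
      Real.log |S.h' i x| - Real.log |S.h' i y| ≤ η := by
    intro i
    obtain ⟨δ₀, hδ₀, h₀⟩ := Metric.uniformContinuousOn_iff.1
      (isCompact_Icc.uniformContinuousOn_of_continuous (S.continuousOn_log_abs_h' i)) η hη
    filter_upwards [Ioo_mem_nhdsGT hδ₀] with δ hδ x hx y hy hxy
    exact (le_abs_self _).trans (h₀ x hx y hy (hxy.trans_lt hδ.2)).le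
  obtain ⟨δ, hδ, hδ₀⟩ := ((eventually_all.2 hunif).and self_mem_nhdsWithin).exists
  have hbdd : ∀ i, ∀ᶠ M in atTop, ∀ x ∈ Icc (0:ℝ) 1, |Real.log (|S.h' i x|)| ≤ M := by
    intro i
    obtain ⟨M₀, hM₀⟩ := isCompact_Icc.exists_bound_of_continuousOn (S.continuousOn_log_abs_h' i)
    filter_upwards [eventually_ge_atTop M₀] with M hM x hx
    exact (hM₀ x hx).trans hM
  obtain ⟨M, hM, hM₀⟩ := ((eventually_all.2 hbdd).and (eventually_ge_atTop (0:ℝ))).exists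
  obtain ⟨N, hN⟩ := S.exists_abs_wMap_sub_le hδ₀
  have key : ∀ w : List I, ∀ x ∈ Icc (0:ℝ) 1, ∀ y ∈ Icc (0:ℝ) 1,
      Real.log |wDeriv S.h S.h' w x| - Real.log |wDeriv S.h S.h' w y| ≤
        (min w.length N : ℕ) * (2 * M) + w.length * η := by
    intro w x hx y hy
    induction w with
    | nil => simp [wDeriv]
    | cons a t ih =>
      rw [S.log_abs_wDeriv_cons a t hx, S.log_abs_wDeriv_cons a t hy, List.length_cons]
      rcases le_or_gt N t.length with hle | hlt
      · have h1 := hδ a _ (S.wMap_mem t hx) _ (S.wMap_mem t hy) (hN t hle x hx y hy)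
        rw [min_eq_right hle] at ih
        rw [min_eq_right (hle.trans t.length.le_succ)]
        push_cast
        linarith
      · have h1 := abs_le.1 (hM a _ (S.wMap_mem t hx))
        have h2 := abs_le.1 (hM a _ (S.wMap_mem t hy))
        rw [min_eq_left hlt.le] at ih
        rw [min_eq_left hlt]
        push_cast
        linarith [h1.2, h2.1]
  refine ⟨N * (2 * M), by positivity, fun w x hx y hy => (key w x hx y hy).trans ?_⟩
  gcongr
  exact min_le_right _ _

/-- The logarithmic distortions of the words of length at most `n`. -/
def logDistortions (n : ℕ) : Set ℝ :=
  {d | ∃ w : List I, w.length ≤ n ∧ ∃ x ∈ Icc (0:ℝ) 1, ∃ y ∈ Icc (0:ℝ) 1,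
    d = Real.log |wDeriv S.h S.h' w x| - Real.log |wDeriv S.h S.h' w y|}

lemma zero_mem_logDistortions (n : ℕ) : 0 ∈ S.logDistortions n :=
  ⟨[], by simp, 0, by simp, 0, by simp, by simp⟩

lemma bddAbove_logDistortions (n : ℕ) : BddAbove (S.logDistortions n) := by
  obtain ⟨C, -, hC⟩ := S.exists_log_distortion_le one_pos
  refine ⟨C + n * 1, ?_⟩
  rintro _ ⟨w, hw, x, hx, y, hy, rfl⟩
  refine (hC w x hx y hy).trans ?_
  gcongr

/-- The largest logarithmic distortion among the words of length at most `n`. -/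
noncomputable def maxLogDistortion (n : ℕ) : ℝ := sSup (S.logDistortions n)

lemma maxLogDistortion_nonneg (n : ℕ) : 0 ≤ S.maxLogDistortion n :=
  le_csSup (S.bddAbove_logDistortions n) (S.zero_mem_logDistortions n)

lemma maxLogDistortion_zero : S.maxLogDistortion 0 = 0 := by
  refine le_antisymm (csSup_le ⟨0, S.zero_mem_logDistortions 0⟩ ?_) (S.maxLogDistortion_nonneg 0)
  rintro _ ⟨w, hw, x, hx, y, hy, rfl⟩
  obtain rfl : w = [] := List.length_eq_zero_iff.1 (Nat.le_zero.1 hw)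
  simp [wDeriv]

lemma monotone_maxLogDistortion : Monotone S.maxLogDistortion := fun m n hmn =>
  csSup_le_csSup (S.bddAbove_logDistortions n) ⟨0, S.zero_mem_logDistortions m⟩
    fun _ ⟨w, hw, h⟩ => ⟨w, hw.trans hmn, h⟩

lemma tendsto_maxLogDistortion_div :
    Tendsto (fun n : ℕ => S.maxLogDistortion n / n) atTop (𝓝 0) := by
  refine Metric.tendsto_atTop'.2 fun ε hε => ?_
  obtain ⟨C, hC₀, hC⟩ := S.exists_log_distortion_le (half_pos hε)
  obtain ⟨N, hN⟩ := exists_nat_gt (C / (ε / 2))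
  refine ⟨N, fun n hn => ?_⟩
  have hn₀ : (0:ℝ) < n := by exact_mod_cast (Nat.zero_le N).trans_lt hn
  have hnN : (N:ℝ) < n := by exact_mod_cast hn
  rw [Real.dist_eq, sub_zero, abs_of_nonneg (div_nonneg (S.maxLogDistortion_nonneg n) hn₀.le),
    div_lt_iff₀ hn₀]
  have hle : S.maxLogDistortion n ≤ C + n * (ε / 2) := by
    refine csSup_le ⟨0, S.zero_mem_logDistortions n⟩ ?_
    rintro _ ⟨w, hw, x, hx, y, hy, rfl⟩
    refine (hC w x hx y hy).trans ?_
    gcongr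
  have hlt : C < n * (ε / 2) := (div_lt_iff₀ (half_pos hε)).1 (hN.trans hnN)
  linarith

lemma abs_wDeriv_le (w : List I) {x y : ℝ} (hx : x ∈ Icc (0:ℝ) 1) (hy : y ∈ Icc (0:ℝ) 1) :
    |wDeriv S.h S.h' w x| ≤ Real.exp (S.maxLogDistortion w.length) * |wDeriv S.h S.h' w y| := by
  have hle : Real.log |wDeriv S.h S.h' w x| - Real.log |wDeriv S.h S.h' w y| ≤
      S.maxLogDistortion w.length :=
    le_csSup (S.bddAbove_logDistortions _) ⟨w, le_rfl, x, hx, y, hy, rfl⟩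
  have hx₀ := abs_pos.2 (S.wDeriv_ne_zero w hx)
  have hy₀ := abs_pos.2 (S.wDeriv_ne_zero w hy)
  rw [← Real.log_le_log_iff hx₀ (by positivity), Real.log_mul (Real.exp_ne_zero _) hy₀.ne',
    Real.log_exp]
  linarith

end PCantorIFS

/-- Tempered distortion property: there is a sequence `pₙ → 0`, with
`n ↦ e^{n pₙ}` non-decreasing, such that `|h_i'(x)| ≤ e^{n pₙ} |h_i'(y)|` for all `i ∈ Iⁿ`
and `x, y ∈ [0,1]`. -/
theorem tempered_distortion {I : Type} [Fintype I] (S : PCantorIFS I) :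
    ∃ p : ℕ → ℝ, Tendsto p atTop (𝓝 0) ∧
      (Monotone fun n : ℕ => Real.exp (n * p n)) ∧
      ∀ n : ℕ, ∀ w : Fin n → I, ∀ x ∈ Icc (0:ℝ) 1, ∀ y ∈ Icc (0:ℝ) 1,
        |wDeriv S.h S.h' (List.ofFn w) x|
          ≤ Real.exp (n * p n) * |wDeriv S.h S.h' (List.ofFn w) y| := by
  have hmul : ∀ n : ℕ, n * (S.maxLogDistortion n / n) = S.maxLogDistortion n := by
    intro n
    rcases Nat.eq_zero_or_pos n with rfl | hn
    · simp [S.maxLogDistortion_zero]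
    · exact mul_div_cancel₀ _ (by positivity)
  refine ⟨fun n => S.maxLogDistortion n / n, S.tendsto_maxLogDistortion_div, ?_, ?_⟩
  · simp only [hmul]
    exact Real.exp_monotone.comp S.monotone_maxLogDistortion
  · intro n w x hx y hy
    simpa only [hmul, List.length_ofFn] using S.abs_wDeriv_le (List.ofFn w) hx hy
end
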